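/- The number of centrally symmetric triangulations of the punctured 2n-gon (the number of vertices of the type-D associahedron d_n) is ((3n-2)/n) * binom(2n-2, n-1). -/

import Mathlib

open scoped BigOperators

/-- `x` lies strictly inside the (clockwise) arc from `a` to `b` of the regular `m`-gon,
whose vertices are labeled by `ZMod m`. -/
def arcMem (m : ℕ) (a b x : ZMod m) : Prop :=
  0 < (x - a).val ∧ (x - a).val < (b - a).val

/-- Ordered version of the crossing predicate for the chords `{a,b}` and `{c,d}`:
exactly one of `c, d` lies strictly inside the open arc from `a` to `b`. -/
def crossPairs (m : ℕ) (a b c d : ZMod m) : Prop :=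
  (arcMem m a b c ∧ arcMem m b a d) ∨ (arcMem m a b d ∧ arcMem m b a c)

/-- Two chords of the convex `m`-gon cross (in their interiors). -/
def Crosses (m : ℕ) (e f : Sym2 (ZMod m)) : Prop :=
  ∃ a b c d : ZMod m, e = s(a, b) ∧ f = s(c, d) ∧ crossPairs m a b c d

/-- `e` is a diagonal of the convex `m`-gon: its endpoints are distinct and non-adjacent. -/
def IsDiagonal (m : ℕ) (e : Sym2 (ZMod m)) : Prop :=
  ∃ a b : ZMod m, e = s(a, b) ∧ a ≠ b ∧ b ≠ a + 1 ∧ a ≠ b + 1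

/-- A triangulation of the convex `m`-gon: a maximal set of pairwise non-crossing diagonals. -/
def IsTriangulation (m : ℕ) (T : Finset (Sym2 (ZMod m))) : Prop :=
  (∀ e ∈ T, IsDiagonal m e) ∧
  (∀ e ∈ T, ∀ f ∈ T, ¬ Crosses m e f) ∧
  (∀ e, IsDiagonal m e → e ∉ T → ∃ f ∈ T, Crosses m e f)

/-- A diagonal of the regular `(2n+2)`-gon is central if it joins two opposite vertices,
i.e. passes through the center of the polygon. -/
def IsCentral (n : ℕ) (e : Sym2 (ZMod (2 * n + 2))) : Prop :=
  ∃ a : ZMod (2 * n + 2), e = s(a, a + (n : ZMod (2 * n + 2)) + 1)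

/-- The central diagonal of the regular `(2n+2)`-gon with endpoint `a`. -/
def centralDiag (n : ℕ) (a : ZMod (2 * n + 2)) : Sym2 (ZMod (2 * n + 2)) :=
  s(a, a + (n : ZMod (2 * n + 2)) + 1)

/-- A centrally-symmetric triangulation of the regular `(2n+2)`-gon: a triangulation invariant
under 180-degree rotation, i.e. under adding `n+1` to every vertex label. -/
def CSTriangulation (n : ℕ) (T : Finset (Sym2 (ZMod (2 * n + 2)))) : Prop :=
  IsTriangulation (2 * n + 2) T ∧
  ∀ e ∈ T, Sym2.map (· + ((n : ZMod (2 * n + 2)) + 1)) e ∈ T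

/-- Chords of the punctured `2n`-gon: non-central diagonals of the `2n`-gon, or central chords
tangent to the central disc, recorded by their polygon vertex together with their orientation
(`true` = emanating clockwise, `false` = counterclockwise). -/
inductive DChord (n : ℕ) where
  | diag : Sym2 (ZMod (2 * n)) → DChord n
  | central : ZMod (2 * n) → Bool → DChord n
deriving DecidableEq

/-- Validity of a chord of the punctured `2n`-gon: a diagonal must have distinct, non-adjacent,
non-opposite endpoints (the segments joining opposite vertices would meet the disc). -/
def DChord.IsValid (n : ℕ) : DChord n → Prop
  | .diag e => ∃ a b : ZMod (2 * n),
      e = s(a, b) ∧ a ≠ b ∧ b ≠ a + 1 ∧ a ≠ b + 1 ∧ b ≠ a + (n : ZMod (2 * n))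
  | .central _ _ => True

/-- A non-central diagonal crosses the central chord at vertex `c` iff it separates `c` from the
central disc, i.e. `c` lies strictly inside the minor arc cut off by the diagonal. -/
def diagCrossCentral (n : ℕ) (e : Sym2 (ZMod (2 * n))) (c : ZMod (2 * n)) : Prop :=
  ∃ a b : ZMod (2 * n), e = s(a, b) ∧ (b - a).val < n ∧ arcMem (2 * n) a b c

/-- The crossing relation for chords of the punctured `2n`-gon.  Two central chords cross iff
they have opposite orientations and are based at different vertex pairs. -/
def DChord.Cross (n : ℕ) : DChord n → DChord n → Prop
  | .diag e, .diag f => Crosses (2 * n) e f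
  | .diag e, .central c _ => diagCrossCentral n e c
  | .central c _, .diag e => diagCrossCentral n e c
  | .central c b, .central d b' => b ≠ b' ∧ d ≠ c ∧ d ≠ c + (n : ZMod (2 * n))

/-- 180-degree rotation of a chord of the punctured `2n`-gon. -/
def DChord.rot (n : ℕ) : DChord n → DChord n
  | .diag e => .diag (Sym2.map (· + (n : ZMod (2 * n))) e)
  | .central c b => .central (c + (n : ZMod (2 * n))) b

/-- A triangulation of the punctured `2n`-gon: a maximal set of pairwise non-crossing chords. -/
def DTriangulation (n : ℕ) (T : Finset (DChord n)) : Prop :=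
  (∀ e ∈ T, DChord.IsValid n e) ∧
  (∀ e ∈ T, ∀ f ∈ T, ¬ DChord.Cross n e f) ∧
  (∀ e, DChord.IsValid n e → e ∉ T → ∃ f ∈ T, DChord.Cross n e f)

/-- A centrally symmetric triangulation of the punctured `2n`-gon: one invariant under
180-degree rotation. -/
def DCSTriangulation (n : ℕ) (T : Finset (DChord n)) : Prop :=
  DTriangulation n T ∧ ∀ e ∈ T, DChord.rot n e ∈ T

/-- A centrally symmetric triangulation of the punctured `2n`-gon, unrolled to the universal
cover: `A a b` says that the diagonal cutting off the boundary arc from `a` to `b` is present,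
`C c s` that the central chord at `c` with orientation `s` is present. -/
structure IsPeriodicTriangulation (n : ℕ) (A : ℤ → ℤ → Prop) (C : ℤ → Bool → Prop) : Prop where
  two_le : ∀ a b : ℤ, A a b → 2 ≤ b - a
  lt_n : ∀ a b : ℤ, A a b → b - a < n
  shift_diag : ∀ a b : ℤ, A (a + n) (b + n) ↔ A a b
  shift_central : ∀ (c : ℤ) (s : Bool), C (c + n) s ↔ C c s
  diag_diag : ∀ a b c d : ℤ, A a b → A c d → a < c → c < b → d ≤ b
  diag_central : ∀ (a b c : ℤ) (s : Bool), A a b → C c s → a < c → b ≤ c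
  central_central : ∀ (c d : ℤ) (s : Bool), C c s → C d (!s) → (n : ℤ) ∣ d - c
  diag_maximal : ∀ a b : ℤ, 2 ≤ b - a → b - a < n → ¬ A a b →
    (∃ c d : ℤ, A c d ∧ (c < a ∧ a < d ∧ d < b ∨ a < c ∧ c < b ∧ b < d)) ∨
      ∃ (c : ℤ) (s : Bool), C c s ∧ a < c ∧ c < b
  central_maximal : ∀ (c : ℤ) (s : Bool), ¬ C c s →
    (∃ a b : ℤ, A a b ∧ a < c ∧ c < b) ∨ ∃ d : ℤ, C d (!s) ∧ ¬ (n : ℤ) ∣ d - c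

/-- An integer sequence with up-steps at most one that rises by `k ≥ 1` over each period `n`. -/
structure IsPotential (n : ℕ) (k : ℤ) (G : ℤ → ℤ) : Prop where
  step : ∀ x, G (x + 1) ≤ G x + 1
  per : ∀ x, G (x + n) = G x + k
  pos : 1 ≤ k

/-- `G` stays above its value at `a` strictly between `a` and `b`, and is at most one step above
it at `b`. -/
def IsArc (G : ℤ → ℤ) (a b : ℤ) : Prop :=
  a < b ∧ (∀ x, a < x → x < b → G a < G x) ∧ G b ≤ G a + 1

/-- `G` stays above its value at `c` from `c` on. -/
def IsLive (G : ℤ → ℤ) (c : ℤ) : Prop := ∀ x, c < x → G c < G x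

/-- The diagonals determined by a potential. -/
def arcDiag (n : ℕ) (G : ℤ → ℤ) (a b : ℤ) : Prop := 2 ≤ b - a ∧ b - a < n ∧ IsArc G a b

/-- The central chords determined by a potential of drift `k` and an orientation. -/
def liveCentral (k : ℤ) (G : ℤ → ℤ) (s : Bool) (c : ℤ) (s' : Bool) : Prop :=
  IsLive G c ∧ (k = 1 ∨ s' = s)

theorem Int.exists_greatest_lt {P : ℤ → Prop} {a b : ℤ} (ha : P a) (hab : a < b) :
    ∃ c, P c ∧ a ≤ c ∧ c < b ∧ ∀ x, c < x → x < b → ¬ P x := by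
  obtain ⟨c, ⟨h1, h2⟩, h3⟩ := Int.exists_greatest_of_bdd (P := fun x => P x ∧ x < b)
    ⟨b, fun z hz => hz.2.le⟩ ⟨a, ha, hab⟩
  refine ⟨c, h1, h3 a ⟨ha, hab⟩, h2, fun x hx hxb hP => ?_⟩
  have := h3 x ⟨hP, hxb⟩
  omega

theorem Int.exists_least_gt {P : ℤ → Prop} {a b : ℤ} (hb : P b) (hab : a < b) :
    ∃ c, P c ∧ a < c ∧ c ≤ b ∧ ∀ x, a < x → x < c → ¬ P x := by
  obtain ⟨c, ⟨h1, h2⟩, h3⟩ := Int.exists_least_of_bdd (P := fun x => P x ∧ a < x)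
    ⟨a, fun z hz => hz.2.le⟩ ⟨b, hb, hab⟩
  refine ⟨c, h1, h2, h3 b ⟨hb, hab⟩, fun x hx hxb hP => ?_⟩
  have := h3 x ⟨hP, hx⟩
  omega

namespace IsPotential

variable {n : ℕ} {k : ℤ} {G : ℤ → ℤ}

theorem isArc_le (hG : IsPotential n k G) (hn : 2 ≤ n) {a b : ℤ} (h : IsArc G a b) :
    b - a ≤ n := by
  obtain ⟨h1, h2, h3⟩ := h
  by_contra hlt
  have e := hG.per (b - n)
  have := h2 (b - n) (by omega) (by omega)
  have := hG.pos
  rw [sub_add_cancel] at e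
  omega

theorem isLive_of_window (hG : IsPotential n k G) (hn : 2 ≤ n) {c : ℤ}
    (h : ∀ x, c < x → x ≤ c + n → G c < G x) : IsLive G c := by
  have key : ∀ m : ℕ, ∀ x, c < x → x ≤ c + m → G c < G x := by
    intro m
    induction m with
    | zero => intro x h1 h2; push_cast at h2; omega
    | succ m ih =>
      intro x h1 h2
      push_cast at h2
      by_cases hx : x ≤ c + n
      · exact h x h1 hx
      · have e := hG.per (x - n)
        have := ih (x - n) (by omega) (by omega)
        have := hG.pos
        rw [sub_add_cancel] at e
        omega
  intro x hx
  exact key (x - c).toNat x hx (by omega)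

theorem isLive_of_isArc (hG : IsPotential n k G) (hn : 2 ≤ n) {a b : ℤ} (h : IsArc G a b)
    (hab : b - a = n) : k = 1 ∧ IsLive G a := by
  obtain ⟨h1, h2, h3⟩ := h
  have hb : b = a + n := by omega
  subst hb
  have e := hG.per a
  have := hG.pos
  refine ⟨by omega, hG.isLive_of_window hn fun x hx hx' => ?_⟩
  rcases eq_or_lt_of_le hx' with rfl | hlt
  · omega
  · exact h2 x hx hlt

theorem isArc_of_isLive (hG : IsPotential n 1 G) (hn : 2 ≤ n) {a : ℤ} (h : IsLive G a) :
    IsArc G a (a + n) :=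
  ⟨by omega, fun x hx _ => h x hx, (hG.per a).le⟩

theorem isLive_add_iff (hG : IsPotential n k G) (c : ℤ) : IsLive G (c + n) ↔ IsLive G c := by
  constructor
  · intro h x hx
    have := h (x + n) (by omega)
    rw [hG.per, hG.per] at this
    omega
  · intro h x hx
    have := h (x - n) (by omega)
    have e := hG.per (x - n)
    rw [sub_add_cancel] at e
    rw [hG.per]
    omega

theorem isArc_add_iff (hG : IsPotential n k G) (a b : ℤ) :
    IsArc G (a + n) (b + n) ↔ IsArc G a b := by
  unfold IsArc
  rw [hG.per, hG.per]
  refine and_congr (by omega) (and_congr ⟨fun h x h1 h2 => ?_, fun h x h1 h2 => ?_⟩ (by omega))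
  · have := h (x + n) (by omega) (by omega)
    rw [hG.per] at this
    omega
  · have := h (x - n) (by omega) (by omega)
    have e := hG.per (x - n)
    rw [sub_add_cancel] at e
    omega

theorem exists_isLive (hG : IsPotential n k G) (hn : 2 ≤ n) : ∃ c, IsLive G c := by
  obtain ⟨z, hz, hmin⟩ := Finset.exists_min_image (Finset.Ico (0 : ℤ) n) G ⟨0, by simp; omega⟩
  simp only [Finset.mem_Ico] at hz hmin
  obtain ⟨c, h1, h2, h3, h4⟩ := Int.exists_greatest_lt (P := fun x => G x ≤ G z) le_rfl hz.2
  refine ⟨c, hG.isLive_of_window hn fun x hx hx' => ?_⟩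
  by_cases hxn : x < n
  · have := h4 x hx hxn
    omega
  · have e := hG.per (x - n)
    rw [sub_add_cancel] at e
    have := hmin (x - n) (by omega)
    have := hG.pos
    omega

/-- A position that is not live lies strictly below an arc ending where the potential first
returns to its value. -/
theorem exists_isArc_over (hG : IsPotential n k G) {a b : ℤ} (hab : a < b)
    (hlt : ∀ x, a < x → x < b → G a < G x) (hb : G b ≤ G a) : ∃ c, c < a ∧ IsArc G c b := by
  have hn : (0 : ℤ) < n := by
    rcases Nat.eq_zero_or_pos n with h | h
    · have e := hG.per 0
      have := hG.pos
      subst h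
      simp at e
      omega
    · exact_mod_cast h
  have e := hG.per (a - n)
  have := hG.pos
  rw [sub_add_cancel] at e
  obtain ⟨c, h1, h2, h3, h4⟩ := Int.exists_greatest_lt (P := fun x => G x < G a)
    (a := a - n) (b := a) (by omega) (by omega)
  have hc : G a ≤ G c + 1 := by
    have s := hG.step c
    by_cases hca : c + 1 = a
    · rw [hca] at s; exact s
    · have := h4 (c + 1) (by omega) (by omega)
      omega
  refine ⟨c, h3, by omega, fun x hx hxb => ?_, by omega⟩
  rcases lt_trichotomy x a with h | h | h
  · have := h4 x hx h
    omega
  · subst h; exact h1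
  · have := hlt x h hxb
    omega

theorem exists_isArc_over_of_not_isLive (hG : IsPotential n k G) {a : ℤ} (h : ¬ IsLive G a) :
    ∃ c b, c < a ∧ a < b ∧ IsArc G c b := by
  simp only [IsLive, not_forall, not_lt] at h
  obtain ⟨y, hy, hy'⟩ := h
  obtain ⟨b, h1, h2, h3, h4⟩ := Int.exists_least_gt (P := fun x => G x ≤ G a) hy' hy
  obtain ⟨c, hc, hc'⟩ := hG.exists_isArc_over h2 (fun x hx hx' => not_le.1 (h4 x hx hx')) h1
  exact ⟨c, b, hc, h2, hc'⟩

theorem isPeriodicTriangulation (hG : IsPotential n k G) (hn : 2 ≤ n) (s : Bool) :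
    IsPeriodicTriangulation n (arcDiag n G) (liveCentral k G s) where
  two_le a b h := h.1
  lt_n a b h := h.2.1
  shift_diag a b := by
    unfold arcDiag
    rw [hG.isArc_add_iff]
    refine and_congr (by omega) (and_congr (by omega) Iff.rfl)
  shift_central c s' := by
    unfold liveCentral
    rw [hG.isLive_add_iff]
  diag_diag := by
    rintro a b c d ⟨-, -, h1, h2, h3⟩ ⟨-, -, h4, h5, h6⟩ hac hcb
    by_contra hbd
    have := h2 c hac hcb
    have := h5 b hcb (by omega)
    omega
  diag_central := by
    rintro a b c s' ⟨-, -, h1, h2, h3⟩ ⟨h4, -⟩ hac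
    by_contra hcb
    have := h2 c hac (by omega)
    have := h4 b (by omega)
    omega
  central_central := by
    rintro c d s' ⟨h1, h2⟩ ⟨h3, h4⟩
    have hk : k = 1 := by
      rcases h2 with h2 | h2
      · exact h2
      · rcases h4 with h4 | h4
        · exact h4
        · subst h2; simp at h4
    subst hk
    have hgt : ∀ (c : ℤ) (j : ℕ), G (c + n * j) = G c + j := by
      intro c j
      induction j with
      | zero => simp
      | succ j ih =>
        have := hG.per (c + n * j)
        push_cast
        rw [mul_add, mul_one, ← add_assoc, this, ih, add_assoc]
    have key : ∀ c d, c ≤ d → IsLive G c → IsLive G d → (n : ℤ) ∣ d - c := by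
      intro c d hcd h1 h3
      have hr := Int.emod_add_mul_ediv (d - c) n
      have hr0 := Int.emod_nonneg (d - c) (b := n) (by omega)
      have hr1 := Int.emod_lt_of_pos (d - c) (b := n) (by omega)
      have hq : 0 ≤ (d - c) / n := Int.ediv_nonneg (by omega) (by omega)
      obtain ⟨q, hq⟩ := Int.eq_ofNat_of_zero_le hq
      rw [hq] at hr
      by_contra hdvd
      have hr2 : (d - c) % n ≠ 0 := fun h => hdvd (Int.dvd_of_emod_eq_zero h)
      have e1 := hgt c q
      have e2 := hG.per (c + n * q)
      have a1 := hgt (c + (d - c) % n) q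
      have e3 : c + (d - c) % n + n * q = d := by linarith
      rw [e3] at a1
      have a2 := h1 (c + (d - c) % n) (by omega)
      have a3 := h3 (c + n * q + n) (by linarith)
      omega
    rcases le_total c d with h | h
    · exact key c d h h1 h3
    · rw [← dvd_neg, neg_sub]
      exact key d c h h3 h1
  diag_maximal := by
    intro a b h2 hlt hA
    have hA' : ¬ IsArc G a b := fun h => hA ⟨h2, hlt, h⟩
    by_cases hx : ∃ x, G x ≤ G a ∧ a < x ∧ x < b
    · obtain ⟨x, hx1, hx2, hx3⟩ := hx
      obtain ⟨y, h1, hy2, h3, h4⟩ := Int.exists_least_gt (P := fun x => G x ≤ G a) hx1 hx2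
      obtain ⟨c, hc, hc'⟩ := hG.exists_isArc_over hy2 (fun x hx hx' => not_le.1 (h4 x hx hx')) h1
      rcases (hG.isArc_le hn hc').eq_or_lt with h | h
      · obtain ⟨rfl, hk⟩ := hG.isLive_of_isArc hn hc' h
        refine Or.inr ⟨y, s, ⟨?_, Or.inl rfl⟩, hy2, by omega⟩
        rw [show y = c + n by omega, hG.isLive_add_iff]
        exact hk
      · exact Or.inl ⟨c, y, ⟨by omega, h, hc'⟩, by omega⟩
    · push Not at hx
      have hb : G a + 2 ≤ G b := by
        by_contra hb
        refine hA' ⟨by omega, fun x hx1 hx2 => ?_, by omega⟩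
        by_contra hle
        have := hx x (by omega) hx1
        omega
      obtain ⟨c, h1, h2', h3, h4⟩ := Int.exists_greatest_lt (P := fun x => G x ≤ G a + 1)
        (a := a + 1) (b := b) (hG.step a) (by omega)
      have hc : ∀ x, c < x → x ≤ b → G c < G x := by
        intro x hx1 hx2
        rcases hx2.eq_or_lt with rfl | hx2
        · omega
        · have := h4 x hx1 hx2
          omega
      by_cases hl : IsLive G c
      · exact Or.inr ⟨c, s, ⟨hl, Or.inr rfl⟩, by omega, h3⟩
      · simp only [IsLive, not_forall, not_lt] at hl
        obtain ⟨y, hy, hy'⟩ := hl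
        obtain ⟨d, g1, g2, g3, g4⟩ := Int.exists_least_gt (P := fun x => G x ≤ G c) hy' hy
        have hbd : b < d := by
          by_contra hbd
          have := hc d g2 (by omega)
          omega
        have harc : IsArc G c d := ⟨g2, fun x hx hx' => not_le.1 (g4 x hx hx'), by omega⟩
        refine Or.inl ⟨c, d, ⟨by omega, ?_, harc⟩, by omega⟩
        rcases (hG.isArc_le hn harc).eq_or_lt with h | h
        · have e := hG.per c
          rw [show c + (n : ℤ) = d by omega] at e
          have := hG.pos
          omega
        · exact h
  central_maximal := by
    intro c s' hC
    by_cases hl : IsLive G c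
    · right
      have hk : k ≠ 1 := fun h => hC ⟨hl, Or.inl h⟩
      have hs : s' ≠ s := fun h => hC ⟨hl, Or.inr h⟩
      have hs' : (!s') = s := by cases s <;> cases s' <;> simp_all
      have hp := hG.pos
      have e := hG.per c
      obtain ⟨d, h1, h2, h3, h4⟩ := Int.exists_greatest_lt (P := fun x => G x ≤ G c + 1)
        (a := c + 1) (b := c + n) (hG.step c) (by omega)
      refine ⟨d, ⟨hG.isLive_of_window hn fun x hx hx' => ?_, Or.inr hs'⟩, ?_⟩
      · rcases lt_trichotomy x (c + n) with h | h | h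
        · have := h4 x hx h
          omega
        · subst h; omega
        · have e' := hG.per (x - n)
          rw [sub_add_cancel] at e'
          have := hl (x - n) (by omega)
          omega
      · intro hd
        have := Int.le_of_dvd (by omega) hd
        omega
    · obtain ⟨a, b, h1, h2, h3⟩ := hG.exists_isArc_over_of_not_isLive hl
      rcases (hG.isArc_le hn h3).eq_or_lt with h | h
      · obtain ⟨rfl, hk⟩ := hG.isLive_of_isArc hn h3 h
        refine Or.inr ⟨a, ⟨hk, Or.inl rfl⟩, fun hd => ?_⟩
        rw [← dvd_neg, neg_sub] at hd
        have := Int.le_of_dvd (by omega) hd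
        omega
      · exact Or.inl ⟨a, b, ⟨by omega, h, h3⟩, h1, h2⟩

end IsPotential

/-- The arcs of a periodic triangulation, completed by the boundary edges and by the loop that
cuts off all but one central position when both central chords at that position are present. -/
def ExtArc (n : ℕ) (A : ℤ → ℤ → Prop) (C : ℤ → Bool → Prop) (a b : ℤ) : Prop :=
  b = a + 1 ∨ A a b ∨ b = a + n ∧ C a true ∧ C a false

open Classical in
/-- The number of completed arcs ending at `b` and starting before `a`. -/
noncomputable def leftCount (n : ℕ) (A : ℤ → ℤ → Prop) (C : ℤ → Bool → Prop) (a b : ℤ) : ℕ :=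
  ((Finset.Ico (b - n) a).filter fun x => ExtArc n A C x b).card

namespace IsPeriodicTriangulation

variable {n : ℕ} {A : ℤ → ℤ → Prop} {C : ℤ → Bool → Prop}

theorem extArc_lt (h : IsPeriodicTriangulation n A C) (hn : 2 ≤ n) {a b : ℤ}
    (hE : ExtArc n A C a b) : a < b ∧ b - a ≤ n := by
  rcases hE with hE | hE | ⟨hE, -⟩
  · omega
  · have := h.two_le a b hE
    have := h.lt_n a b hE
    omega
  · omega

theorem central_extArc (h : IsPeriodicTriangulation n A C) {a b c : ℤ} {s : Bool}
    (hE : ExtArc n A C a b) (hc : C c s) (hac : a < c) : b ≤ c := by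
  rcases hE with hE | hE | ⟨hE, h1, h2⟩
  · omega
  · exact h.diag_central a b c s hE hc hac
  · have hd : (n : ℤ) ∣ c - a := by
      cases s
      · exact h.central_central a c true h1 hc
      · exact h.central_central a c false h2 hc
    have := Int.le_of_dvd (by omega) hd
    omega

theorem extArc_extArc (h : IsPeriodicTriangulation n A C) {a b c d : ℤ}
    (h1 : ExtArc n A C a b) (h2 : ExtArc n A C c d) (hac : a < c) (hcb : c < b) : d ≤ b := by
  have h1' := h1
  rcases h2 with h2 | h2 | ⟨h2, h3, h4⟩
  · omega
  · rcases h1 with h1 | h1 | ⟨h1, h5, h6⟩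
    · omega
    · exact h.diag_diag a b c d h1 h2 hac hcb
    · subst h1
      exact h.diag_central c d (a + n) true h2 ((h.shift_central a true).2 h5) hcb
  · have := h.central_extArc h1' h3 hac
    omega

theorem exists_apex (h : IsPeriodicTriangulation n A C) (hn : 2 ≤ n) {a b : ℤ}
    (hE : ExtArc n A C a b) (hab : 2 ≤ b - a) :
    ∃ m, a < m ∧ m < b ∧ ExtArc n A C a m ∧ ExtArc n A C m b := by
  obtain ⟨m, h1, h2, h3, h4⟩ := Int.exists_greatest_lt (P := fun x => ExtArc n A C a x)
    (a := a + 1) (b := b) (Or.inl rfl) (by omega)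
  refine ⟨m, by omega, h3, h1, ?_⟩
  by_cases hb : b = m + 1
  · exact Or.inl hb
  refine Or.inr (Or.inl ?_)
  by_contra hA
  have hl := h.extArc_lt hn hE
  rcases h.diag_maximal m b (by omega) (by omega) hA with
    ⟨c, d, hcd, ⟨g1, g2, g3⟩ | ⟨g1, g2, g3⟩⟩ | ⟨c, s, hc, g1, g2⟩
  · have hcd' : ExtArc n A C c d := Or.inr (Or.inl hcd)
    rcases lt_trichotomy c a with g | g | g
    · have := h.extArc_extArc hcd' hE g (by omega)
      omega
    · subst g
      exact h4 d g2 g3 hcd'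
    · have := h.extArc_extArc h1 hcd' g g1
      omega
  · have := h.extArc_extArc hE (Or.inr (Or.inl hcd)) (by omega) g2
    omega
  · have := h.central_extArc hE hc (by omega)
    omega

theorem leftCount_eq_zero (h : IsPeriodicTriangulation n A C) {a m b : ℤ}
    (h1 : ExtArc n A C a b) (ham : a < m) (hmb : m < b) : leftCount n A C a m = 0 := by
  classical
  rw [leftCount, Finset.card_eq_zero, Finset.filter_eq_empty_iff]
  intro x hx hE
  have hx' := Finset.mem_Ico.1 hx
  have := h.extArc_extArc hE h1 hx'.2 ham
  omega

theorem leftCount_apex (h : IsPeriodicTriangulation n A C) (hn : 2 ≤ n) {a m b : ℤ}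
    (h1 : ExtArc n A C a b) (h2 : ExtArc n A C a m) (ham : a < m) (hmb : m < b) :
    leftCount n A C m b = leftCount n A C a b + 1 := by
  have hl := h.extArc_lt hn h1
  rw [leftCount, leftCount, ← Finset.card_insert_of_notMem (a := a) (by simp)]
  congr 1
  ext x
  simp only [Finset.mem_filter, Finset.mem_insert, Finset.mem_Ico]
  constructor
  · rintro ⟨⟨g1, g2⟩, g3⟩
    rcases lt_trichotomy x a with g | g | g
    · exact Or.inr ⟨⟨g1, g⟩, g3⟩
    · exact Or.inl g
    · have := h.extArc_extArc h2 g3 g g2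
      omega
  · rintro (rfl | ⟨⟨g1, g2⟩, g3⟩)
    · exact ⟨⟨by omega, ham⟩, h1⟩
    · exact ⟨⟨g1, by omega⟩, g3⟩

variable {G : ℤ → ℤ}

theorem extArc_height (h : IsPeriodicTriangulation n A C) (hn : 2 ≤ n)
    (hG : ∀ x, G x = G (x - 1) + 1 - leftCount n A C (x - 1) x) {a b : ℤ}
    (hE : ExtArc n A C a b) :
    G b = G a + 1 - leftCount n A C a b ∧ ∀ x, a < x → x < b → G a < G x := by
  suffices key : ∀ m : ℕ, ∀ a b : ℤ, b - a ≤ m → ExtArc n A C a b →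
      G b = G a + 1 - leftCount n A C a b ∧ ∀ x, a < x → x < b → G a < G x from
    key (b - a).toNat a b (by omega) hE
  intro m
  induction m with
  | zero =>
    intro a b hab hE
    have := h.extArc_lt hn hE
    push_cast at hab
    omega
  | succ m ih =>
    intro a b hab hE
    push_cast at hab
    have hl := h.extArc_lt hn hE
    by_cases hb : b = a + 1
    · subst hb
      have := hG (a + 1)
      rw [add_sub_cancel_right] at this
      exact ⟨this, fun x h1 h2 => by omega⟩
    · obtain ⟨y, h1, h2, h3, h4⟩ := h.exists_apex hn hE (by omega)
      obtain ⟨i1, i2⟩ := ih a y (by omega) h3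
      obtain ⟨i3, i4⟩ := ih y b (by omega) h4
      rw [h.leftCount_eq_zero hE h1 h2] at i1
      rw [h.leftCount_apex hn hE h3 h1 h2] at i3
      push_cast at i1 i3
      refine ⟨by omega, fun x hx hx' => ?_⟩
      rcases lt_trichotomy x y with g | g | g
      · exact i2 x hx g
      · subst g; omega
      · have := i4 x g hx'
        omega

theorem central_height_aux (h : IsPeriodicTriangulation n A C) (hn : 2 ≤ n)
    (hG : ∀ x, G x = G (x - 1) + 1 - leftCount n A C (x - 1) x) {c b : ℤ} {s : Bool}
    (hc : C c s) (hcb : c < b) :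
    ∃ a, c ≤ a ∧ a < b ∧ ExtArc n A C a b ∧ G b = G a + 1 := by
  obtain ⟨a, h1, h2, h3, h4⟩ := Int.exists_least_gt (P := fun x => ExtArc n A C x b)
    (a := c - 1) (b := b - 1) (Or.inl (by omega)) (by omega)
  refine ⟨a, by omega, by omega, h1, ?_⟩
  have h0 : leftCount n A C a b = 0 := by
    classical
    rw [leftCount, Finset.card_eq_zero, Finset.filter_eq_empty_iff]
    intro x hx hE
    have hx' := Finset.mem_Ico.1 hx
    by_cases hxc : x < c
    · have := h.central_extArc hE hc hxc
      omega
    · exact h4 x (by omega) hx'.2 hE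
  have := (h.extArc_height hn hG h1).1
  rw [h0] at this
  omega

theorem isLive_of_central (h : IsPeriodicTriangulation n A C) (hn : 2 ≤ n)
    (hG : ∀ x, G x = G (x - 1) + 1 - leftCount n A C (x - 1) x) {c : ℤ} {s : Bool}
    (hc : C c s) : IsLive G c := by
  have key : ∀ m : ℕ, ∀ b, c < b → b - c ≤ m → G c < G b := by
    intro m
    induction m with
    | zero => intro b h1 h2; push_cast at h2; omega
    | succ m ih =>
      intro b h1 h2
      push_cast at h2
      obtain ⟨a, g1, g2, -, g3⟩ := h.central_height_aux hn hG hc h1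
      rcases g1.eq_or_lt with rfl | g1
      · omega
      · have := ih a g1 (by omega)
        omega
  intro x hx
  exact key (x - c).toNat x hx (by omega)

theorem exists_central (h : IsPeriodicTriangulation n A C) : ∃ c s, C c s := by
  by_contra hC
  push Not at hC
  have step : ∀ a b, A a b → ∃ a' b', A a' b' ∧ b - a < b' - a' := by
    intro a b hab
    rcases h.central_maximal a true (hC a true) with ⟨c, d, h1, h2, h3⟩ | ⟨d, hd, -⟩
    · have := h.diag_diag c d a b h1 hab h2 h3
      exact ⟨c, d, h1, by omega⟩
    · exact (hC d _ hd).elim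
  have key : ∀ m : ℕ, ∃ a b, A a b ∧ (m : ℤ) ≤ b - a := by
    intro m
    induction m with
    | zero =>
      rcases h.central_maximal 0 true (hC 0 true) with ⟨c, d, h1, h2, h3⟩ | ⟨d, hd, -⟩
      · exact ⟨c, d, h1, by push_cast; omega⟩
      · exact (hC d _ hd).elim
    | succ m ih =>
      obtain ⟨a, b, h1, h2⟩ := ih
      obtain ⟨a', b', h3, h4⟩ := step a b h1
      exact ⟨a', b', h3, by push_cast; omega⟩
  obtain ⟨a, b, h1, h2⟩ := key n
  have := h.lt_n a b h1
  omega

theorem extArc_add_iff (h : IsPeriodicTriangulation n A C) (a b : ℤ) :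
    ExtArc n A C (a + n) (b + n) ↔ ExtArc n A C a b := by
  unfold ExtArc
  rw [h.shift_diag, h.shift_central, h.shift_central]
  refine or_congr (by omega) (or_congr Iff.rfl (and_congr (by omega) Iff.rfl))

theorem leftCount_add (h : IsPeriodicTriangulation n A C) (a b : ℤ) :
    leftCount n A C (a + n) (b + n) = leftCount n A C a b := by
  rw [leftCount, leftCount]
  refine (Finset.card_bij (fun x _ => x + (n : ℤ)) ?_ ?_ ?_).symm
  · intro x hx
    simp only [Finset.mem_filter, Finset.mem_Ico, h.extArc_add_iff] at hx ⊢
    exact ⟨by omega, hx.2⟩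
  · intro x _ y _ hxy
    omega
  · intro y hy
    simp only [Finset.mem_filter, Finset.mem_Ico] at hy
    refine ⟨y - n, ?_, by omega⟩
    simp only [Finset.mem_filter, Finset.mem_Ico, ← h.extArc_add_iff (y - n) b, sub_add_cancel]
    exact ⟨by omega, hy.2⟩

theorem isPotential (h : IsPeriodicTriangulation n A C) (hn : 2 ≤ n) {k : ℤ}
    (hG : ∀ x, G x = G (x - 1) + 1 - leftCount n A C (x - 1) x)
    (hper : ∀ x, G (x + n) = G x + k) : IsPotential n k G where
  step x := by
    have := hG (x + 1)
    rw [add_sub_cancel_right] at this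
    omega
  per := hper
  pos := by
    obtain ⟨c, s, hc⟩ := h.exists_central
    have := h.isLive_of_central hn hG hc (c + n) (by omega)
    have := hper c
    omega

theorem isArc_of_extArc (h : IsPeriodicTriangulation n A C) (hn : 2 ≤ n)
    (hG : ∀ x, G x = G (x - 1) + 1 - leftCount n A C (x - 1) x) {a b : ℤ}
    (hE : ExtArc n A C a b) : IsArc G a b := by
  obtain ⟨h1, h2⟩ := h.extArc_height hn hG hE
  exact ⟨(h.extArc_lt hn hE).1, h2, by omega⟩

theorem diag_iff_arcDiag (h : IsPeriodicTriangulation n A C) (hn : 2 ≤ n)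
    (hG : ∀ x, G x = G (x - 1) + 1 - leftCount n A C (x - 1) x) (a b : ℤ) :
    A a b ↔ arcDiag n G a b := by
  constructor
  · intro hA
    exact ⟨h.two_le a b hA, h.lt_n a b hA, h.isArc_of_extArc hn hG (Or.inr (Or.inl hA))⟩
  · rintro ⟨h1, h2, h3, h4, h5⟩
    by_contra hA
    rcases h.diag_maximal a b h1 h2 hA with
      ⟨c, d, hcd, ⟨g1, g2, g3⟩ | ⟨g1, g2, g3⟩⟩ | ⟨c, s, hc, g1, g2⟩
    · obtain ⟨-, f1, f2⟩ := h.isArc_of_extArc hn hG (Or.inr (Or.inl hcd))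
      have := f1 a g1 g2
      have := h4 d g2 g3
      omega
    · obtain ⟨-, f1, f2⟩ := h.isArc_of_extArc hn hG (Or.inr (Or.inl hcd))
      have := f1 b g2 g3
      have := h4 c g1 g2
      omega
    · have := h.isLive_of_central hn hG hc b g2
      have := h4 c g1 g2
      omega

theorem exists_central_of_isLive (h : IsPeriodicTriangulation n A C) (hn : 2 ≤ n)
    (hG : ∀ x, G x = G (x - 1) + 1 - leftCount n A C (x - 1) x) {c : ℤ} (hc : IsLive G c) :
    ∃ s, C c s := by
  have hover : ∀ a b, ExtArc n A C a b → a < c → c < b → False := by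
    intro a b hE h1 h2
    obtain ⟨-, f1, f2⟩ := h.isArc_of_extArc hn hG hE
    have := f1 c h1 h2
    have := hc b h2
    omega
  by_contra hC
  push Not at hC
  rcases h.central_maximal c true (hC true) with ⟨a, b, h1, h2, h3⟩ | ⟨d, hd, hdc⟩
  · exact hover a b (Or.inr (Or.inl h1)) h2 h3
  rcases h.central_maximal c false (hC false) with ⟨a, b, h1, h2, h3⟩ | ⟨e, he, hec⟩
  · exact hover a b (Or.inr (Or.inl h1)) h2 h3
  simp only [Bool.not_true, Bool.not_false] at hd he
  have hshift : ∀ (s : Bool) (x : ℤ) (j : ℤ), C (x + n * j) s ↔ C x s := by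
    intro s x j
    have hp : Function.Periodic (fun x => C x s) (n : ℤ) := fun x => propext (h.shift_central x s)
    have := hp.int_mul j x
    rw [mul_comm]
    exact iff_of_eq this
  obtain ⟨j, hj⟩ := h.central_central d e false hd he
  have he' : C d true := by
    rw [show e = d + n * j by omega, hshift] at he
    exact he
  have hr := Int.emod_add_mul_ediv (c - d) n
  have hr0 := Int.emod_nonneg (c - d) (b := n) (by omega)
  have hr1 := Int.emod_lt_of_pos (c - d) (b := n) (by omega)
  have hr2 : (c - d) % n ≠ 0 := fun h0 => hdc (by
    rw [← dvd_neg, neg_sub]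
    exact Int.dvd_of_emod_eq_zero h0)
  refine hover (d + n * ((c - d) / n)) (d + n * ((c - d) / n) + n) (Or.inr (Or.inr ?_))
    (by omega) (by omega)
  rw [hshift, hshift]
  exact ⟨rfl, he', hd⟩

theorem both_central_iff (h : IsPeriodicTriangulation n A C) (hn : 2 ≤ n) {k : ℤ}
    (hG : ∀ x, G x = G (x - 1) + 1 - leftCount n A C (x - 1) x)
    (hper : ∀ x, G (x + n) = G x + k) {c : ℤ} {s : Bool} (hc : C c s) :
    k = 1 ↔ C c (!s) := by
  have hp := (h.isPotential hn hG hper).pos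
  have hkc := hper c
  constructor
  · rintro rfl
    obtain ⟨a, h1, h2, h3, h4⟩ := h.central_height_aux hn hG hc (b := c + n) (by omega)
    rcases h1.eq_or_lt with rfl | h1
    · rcases h3 with h3 | h3 | ⟨-, h5, h6⟩
      · omega
      · have := h.lt_n _ _ h3
        omega
      · cases s
        · exact h5
        · exact h6
    · have := h.isLive_of_central hn hG hc a h1
      omega
  · intro hc'
    have hE : ExtArc n A C c (c + n) :=
      by
      cases s
      · exact Or.inr (Or.inr ⟨rfl, hc', hc⟩)
      · exact Or.inr (Or.inr ⟨rfl, hc, hc'⟩)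
    obtain ⟨-, -, h1⟩ := h.isArc_of_extArc hn hG hE
    omega

theorem exists_central_iff_liveCentral (h : IsPeriodicTriangulation n A C) (hn : 2 ≤ n) {k : ℤ}
    (hG : ∀ x, G x = G (x - 1) + 1 - leftCount n A C (x - 1) x)
    (hper : ∀ x, G (x + n) = G x + k) :
    ∃ s, (k = 1 → s = true) ∧ ∀ c s', C c s' ↔ liveCentral k G s c s' := by
  by_cases hk : k = 1
  · refine ⟨true, fun _ => rfl, fun c s' => ⟨fun hC => ⟨h.isLive_of_central hn hG hC, Or.inl hk⟩,
      fun hl => ?_⟩⟩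
    obtain ⟨t, ht⟩ := h.exists_central_of_isLive hn hG hl.1
    have ht' := (h.both_central_iff hn hG hper ht).1 hk
    cases s' <;> cases t <;> assumption
  · obtain ⟨c₀, s, hs⟩ := h.exists_central
    have huniq : ∀ c s', C c s' → s' = s := by
      intro c s' hC
      by_contra hne
      have hs' : s' = !s := Bool.eq_not.2 hne
      subst hs'
      obtain ⟨j, hj⟩ := h.central_central c₀ c s hs hC
      have hp : Function.Periodic (fun x => C x s) (n : ℤ) :=
        fun x => propext (h.shift_central x s)
      have := hp.int_mul j c₀
      rw [mul_comm, Int.cast_id, ← hj, add_sub_cancel] at this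
      exact hk ((h.both_central_iff hn hG hper ((iff_of_eq this).2 hs)).2 hC)
    refine ⟨s, fun h1 => (hk h1).elim, fun c s' => ⟨fun hC =>
      ⟨h.isLive_of_central hn hG hC, Or.inr (huniq c s' hC)⟩, ?_⟩⟩
    rintro ⟨hl, hl' | rfl⟩
    · exact (hk hl').elim
    · obtain ⟨t, ht⟩ := h.exists_central_of_isLive hn hG hl
      rwa [← huniq c t ht]

end IsPeriodicTriangulation

/-- The potential with increments `1 - d x`, normalized to vanish at `0`. -/
noncomputable def potentialOf {n : ℕ} (d : ZMod n → ℕ) (x : ℤ) : ℤ :=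
  x - ∑ i ∈ Finset.Ioc 0 x, (d i : ℤ) + ∑ i ∈ Finset.Ioc x 0, (d i : ℤ)

theorem potentialOf_sub_one {n : ℕ} (d : ZMod n → ℕ) (x : ℤ) :
    potentialOf d x = potentialOf d (x - 1) + 1 - d x := by
  unfold potentialOf
  rcases lt_or_ge 0 x with hx | hx
  · have e : Finset.Ioc 0 x = insert x (Finset.Ioc 0 (x - 1)) := by
      ext y; simp only [Finset.mem_insert, Finset.mem_Ioc]; omega
    rw [e, Finset.sum_insert (by simp), Finset.Ioc_eq_empty_of_le (by omega : (0 : ℤ) ≤ x),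
      Finset.Ioc_eq_empty_of_le (by omega : (0 : ℤ) ≤ x - 1)]
    simp only [Finset.sum_empty]
    ring
  · have e : Finset.Ioc (x - 1) 0 = insert x (Finset.Ioc x 0) := by
      ext y; simp only [Finset.mem_insert, Finset.mem_Ioc]; omega
    rw [e, Finset.sum_insert (by simp), Finset.Ioc_eq_empty_of_le hx,
      Finset.Ioc_eq_empty_of_le (by omega : x - 1 ≤ 0)]
    simp only [Finset.sum_empty]
    ring

theorem sum_Ioc_intCast_zmod {n : ℕ} [NeZero n] (d : ZMod n → ℕ) :
    ∑ i ∈ Finset.Ioc (0 : ℤ) n, (d i : ℤ) = ∑ z, (d z : ℤ) := by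
  refine Finset.sum_bij (fun x _ => (x : ZMod n)) (fun _ _ => Finset.mem_univ _) ?_ ?_
    (fun _ _ => rfl)
  · intro x hx y hy hxy
    rw [Finset.mem_Ioc] at hx hy
    rw [ZMod.intCast_eq_intCast_iff_dvd_sub] at hxy
    have := Int.eq_zero_of_abs_lt_dvd hxy (abs_lt.2 (by omega))
    omega
  · intro z _
    refine ⟨((z - 1).val : ℤ) + 1, ?_, by simp⟩
    have := ZMod.val_lt (z - 1)
    rw [Finset.mem_Ioc]
    omega

theorem potentialOf_add {n : ℕ} [NeZero n] (d : ZMod n → ℕ) (x : ℤ) :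
    potentialOf d (x + n) = potentialOf d x + (n - ∑ z, (d z : ℤ)) := by
  have step : ∀ y : ℤ, potentialOf d (y + n) - potentialOf d y =
      potentialOf d (y - 1 + n) - potentialOf d (y - 1) := by
    intro y
    have h1 := potentialOf_sub_one d (y + n)
    have h2 := potentialOf_sub_one d y
    rw [show y + (n : ℤ) - 1 = y - 1 + n by ring] at h1
    have e : ((y + n : ℤ) : ZMod n) = y := by simp
    rw [e] at h1
    omega
  have h0 : potentialOf d ((0 : ℤ) + n) - potentialOf d 0 = n - ∑ z, (d z : ℤ) := by
    rw [zero_add, ← sum_Ioc_intCast_zmod d]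
    simp [potentialOf]
  have key : ∀ y : ℤ, potentialOf d (y + n) - potentialOf d y = n - ∑ z, (d z : ℤ) := by
    intro y
    induction y using Int.induction_on with
    | zero => exact h0
    | succ i ih =>
      have := step (i + 1)
      rw [add_sub_cancel_right] at this
      rw [this, ih]
    | pred i ih =>
      rw [← step, ih]
  have := key x
  omega

theorem isPotential_potentialOf {n : ℕ} [NeZero n] (d : ZMod n → ℕ) (hd : ∑ z, d z + 1 ≤ n) :
    IsPotential n (n - ∑ z, (d z : ℤ)) (potentialOf d) where
  step x := by
    have := potentialOf_sub_one d (x + 1)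
    rw [add_sub_cancel_right] at this
    omega
  per := potentialOf_add d
  pos := by
    zify at hd
    omega

namespace IsPotential

variable {n : ℕ} {k : ℤ} {G : ℤ → ℤ}

theorem extArc_iff (hG : IsPotential n k G) (hn : 2 ≤ n) {s : Bool} (a b : ℤ) :
    ExtArc n (arcDiag n G) (liveCentral k G s) a b ↔ IsArc G a b := by
  constructor
  · rintro (rfl | h | ⟨rfl, ⟨h1, h2⟩, ⟨-, h3⟩⟩)
    · exact ⟨by omega, fun x _ _ => by omega, hG.step a⟩
    · exact h.2.2
    · have hk : k = 1 := by
        rcases h2 with h2 | rfl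
        · exact h2
        · simpa using h3
      subst hk
      exact hG.isArc_of_isLive hn h1
  · intro h
    have hle := hG.isArc_le hn h
    have hlt := h.1
    by_cases h1 : b = a + 1
    · exact Or.inl h1
    rcases hle.eq_or_lt with h2 | h2
    · obtain ⟨hk, hl⟩ := hG.isLive_of_isArc hn h h2
      exact Or.inr (Or.inr ⟨by omega, ⟨hl, Or.inl hk⟩, ⟨hl, Or.inl hk⟩⟩)
    · exact Or.inr (Or.inl ⟨by omega, h2, h⟩)

theorem leftCount_eq (hG : IsPotential n k G) (hn : 2 ≤ n) {s : Bool} {b : ℤ} {e : ℕ}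
    (he : G b = G (b - 1) + 1 - e) :
    leftCount n (arcDiag n G) (liveCentral k G s) (b - 1) b = e := by
  classical
  have hcard : e = (Finset.Icc (1 : ℤ) e).card := by simp
  rw [hcard, leftCount]
  refine Finset.card_bij (fun a _ => G (b - 1) - G a) ?_ ?_ ?_
  · intro a ha
    simp only [Finset.mem_filter, Finset.mem_Ico, hG.extArc_iff hn] at ha
    obtain ⟨⟨h1, h2⟩, h3, h4, h5⟩ := ha
    have := h4 (b - 1) h2 (by omega)
    rw [Finset.mem_Icc]
    omega
  · intro a ha a' ha' heq
    simp only [Finset.mem_filter, Finset.mem_Ico, hG.extArc_iff hn] at ha ha'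
    by_contra hne
    rcases lt_or_gt_of_ne hne with h | h
    · have := ha.2.2.1 a' h (by omega)
      omega
    · have := ha'.2.2.1 a h (by omega)
      omega
  · intro y hy
    rw [Finset.mem_Icc] at hy
    have hdown : ∀ j : ℕ, G (b - 1 - n * j) = G (b - 1) - k * j := by
      intro j
      induction j with
      | zero => simp
      | succ j ih =>
        have := hG.per (b - 1 - n * (j + 1))
        rw [show b - 1 - (n : ℤ) * (j + 1) + n = b - 1 - n * j by ring, ih] at this
        push_cast
        linarith
    have hk := hG.pos
    have h0 : G (b - 1 - n * y.toNat) ≤ G (b - 1) - y := by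
      rw [hdown, Int.toNat_of_nonneg (by omega)]
      nlinarith
    have hlt : b - 1 - (n : ℤ) * y.toNat < b - 1 := by
      have : 0 < y.toNat := by omega
      have : 0 < (n : ℤ) * y.toNat := by positivity
      omega
    obtain ⟨a, h1, -, h3, h4⟩ :=
      Int.exists_greatest_lt (P := fun x => G x ≤ G (b - 1) - y) h0 hlt
    have hay : G a = G (b - 1) - y := by
      have := hG.step a
      by_cases hb : a + 1 = b - 1
      · rw [hb] at this
        omega
      · have := h4 (a + 1) (by omega) (by omega)
        omega
    have harc : IsArc G a b := by
      refine ⟨by omega, fun x hx hx' => ?_, by omega⟩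
      rcases eq_or_ne x (b - 1) with rfl | hne
      · omega
      · have := h4 x hx (by omega)
        omega
    have := hG.isArc_le hn harc
    refine ⟨a, ?_, by omega⟩
    simp only [Finset.mem_filter, Finset.mem_Ico, hG.extArc_iff hn]
    exact ⟨by omega, harc⟩

end IsPotential

/-- Pairs of a sequence on `ZMod n` of total less than `n` and an orientation, the latter being
normalized when the total is `n - 1`. -/
def ChordCode (n : ℕ) [NeZero n] : Type :=
  {p : (ZMod n → ℕ) × Bool // ∑ z, p.1 z + 1 ≤ n ∧ (∑ z, p.1 z + 1 = n → p.2 = true)}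

namespace ChordCode

variable {n : ℕ} [NeZero n]

/-- The diagonals encoded by a chord code. -/
def diag (p : ChordCode n) : ℤ → ℤ → Prop := arcDiag n (potentialOf p.1.1)

/-- The central chords encoded by a chord code. -/
def central (p : ChordCode n) : ℤ → Bool → Prop :=
  liveCentral (n - ∑ z, (p.1.1 z : ℤ)) (potentialOf p.1.1) p.1.2

theorem isPotential (p : ChordCode n) :
    IsPotential n (n - ∑ z, (p.1.1 z : ℤ)) (potentialOf p.1.1) :=
  isPotential_potentialOf p.1.1 p.2.1

theorem ext_of_chords (hn : 2 ≤ n) {p q : ChordCode n} (h1 : p.diag = q.diag)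
    (h2 : p.central = q.central) : p = q := by
  have hd : p.1.1 = q.1.1 := by
    funext z
    obtain ⟨x, rfl⟩ := ZMod.intCast_surjective z
    rw [← p.isPotential.leftCount_eq hn (s := p.1.2) (potentialOf_sub_one p.1.1 x),
      ← q.isPotential.leftCount_eq hn (s := q.1.2) (potentialOf_sub_one q.1.1 x)]
    change leftCount n p.diag p.central _ _ = leftCount n q.diag q.central _ _
    rw [h1, h2]
  refine Subtype.ext (Prod.ext hd ?_)
  obtain ⟨c, hc⟩ := p.isPotential.exists_isLive hn
  have hpc : p.central c p.1.2 := ⟨hc, Or.inr rfl⟩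
  rw [h2] at hpc
  rcases hpc.2 with hk | hk
  · have hq : ∑ z, q.1.1 z + 1 = n := by zify; omega
    rw [q.2.2 hq, p.2.2 (hd ▸ hq)]
  · exact hk

theorem exists_eq_chords (hn : 2 ≤ n) {A : ℤ → ℤ → Prop} {C : ℤ → Bool → Prop}
    (h : IsPeriodicTriangulation n A C) : ∃ p : ChordCode n, p.diag = A ∧ p.central = C := by
  let d : ZMod n → ℕ := fun z => leftCount n A C ((z.val : ℤ) - 1) z.val
  have hd : ∀ x : ℤ, d x = leftCount n A C (x - 1) x := by
    intro x
    have hp : Function.Periodic (fun x => leftCount n A C (x - 1) x) (n : ℤ) := fun x => by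
      change leftCount n A C (x + n - 1) (x + n) = _
      rw [add_sub_right_comm, h.leftCount_add]
    have := hp.int_mul (x / n) (x % n)
    simp only [Int.cast_id, mul_comm _ (n : ℤ), Int.emod_add_mul_ediv] at this
    simp only [d, ZMod.val_intCast]
    exact this.symm
  have hG : ∀ x, potentialOf d x = potentialOf d (x - 1) + 1 - leftCount n A C (x - 1) x := by
    intro x
    rw [← hd, ← potentialOf_sub_one]
  have hper := potentialOf_add d
  have hpos := (h.isPotential hn hG hper).pos
  obtain ⟨s, hs1, hs2⟩ := h.exists_central_iff_liveCentral hn hG hper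
  refine ⟨⟨(d, s), by zify; omega, fun heq => hs1 (by zify at heq; omega)⟩, ?_, ?_⟩
  · funext a b
    exact propext (h.diag_iff_arcDiag hn hG a b).symm
  · funext c s'
    exact propext (hs2 c s').symm

end ChordCode

theorem card_sum_le {α : Type*} [Fintype α] (j : ℕ) :
    Nat.card {f : α → ℕ // ∑ i, f i ≤ j} = (Fintype.card α + j).choose j := by
  classical
  have e : {f : α → ℕ // ∑ i, f i ≤ j} ≃ {f : Option α → ℕ // ∑ i, f i = j} :=
    { toFun := fun f => ⟨fun o => o.elim (j - ∑ i, f.1 i) f.1, by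
        rw [Fintype.sum_option]
        exact Nat.sub_add_cancel f.2⟩
      invFun := fun f => ⟨fun i => f.1 (some i), by
        have := f.2
        rw [Fintype.sum_option] at this
        change ∑ i, f.1 (some i) ≤ j
        omega⟩
      left_inv := fun f => rfl
      right_inv := fun f => by
        have := f.2
        rw [Fintype.sum_option] at this
        refine Subtype.ext (funext fun o => ?_)
        cases o with
        | none =>
          change j - ∑ i, f.1 (some i) = f.1 none
          omega
        | some i => rfl }
  rw [Nat.card_congr (e.trans (Sym.equivNatSumOfFintype (Option α) j).symm),
    Nat.card_eq_fintype_card, Sym.card_sym_eq_choose, Fintype.card_option]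
  congr 1
  omega

theorem finite_sum_le {α : Type*} [Fintype α] (j : ℕ) : Finite {f : α → ℕ // ∑ i, f i ≤ j} :=
  Nat.finite_of_card_ne_zero (by
    rw [card_sum_le]
    exact (Nat.choose_pos (by omega)).ne')

theorem ChordCode.card {n : ℕ} [NeZero n] (hn : 2 ≤ n) :
    n * Nat.card (ChordCode n) = (3 * n - 2) * Nat.choose (2 * n - 2) (n - 1) := by
  have e : ChordCode n ≃ {f : ZMod n → ℕ // ∑ i, f i ≤ n - 1} ⊕
      {f : ZMod n → ℕ // ∑ i, f i ≤ n - 2} :=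
    { toFun := fun
        | ⟨(f, true), h⟩ => Sum.inl ⟨f, by have := h.1; simp only at this; omega⟩
        | ⟨(f, false), h⟩ => Sum.inr ⟨f, by
            have h1 := h.1
            have h2 : ∑ z, f z + 1 ≠ n := fun he => Bool.false_ne_true (h.2 he)
            simp only at h1
            omega⟩
      invFun := fun
        | Sum.inl f => ⟨(f.1, true), by have := f.2; simp only; omega, fun _ => rfl⟩
        | Sum.inr f => ⟨(f.1, false), by have := f.2; simp only; omega, fun he => by
            have := f.2
            simp only at he
            omega⟩
      left_inv := by rintro ⟨⟨f, _ | _⟩, h⟩ <;> rfl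
      right_inv := by rintro (f | f) <;> rfl }
  have := finite_sum_le (α := ZMod n) (n - 1)
  have := finite_sum_le (α := ZMod n) (n - 2)
  rw [Nat.card_congr e, Nat.card_sum, card_sum_le, card_sum_le, ZMod.card]
  obtain ⟨p, rfl⟩ := Nat.exists_eq_add_of_le hn
  rw [show 2 + p + (2 + p - 1) = 2 * p + 2 + 1 by omega,
    show 2 + p + (2 + p - 2) = 2 * p + 2 by omega, show 2 + p - 1 = p + 1 by omega,
    show 2 + p - 2 = p by omega, show 2 * (2 + p) - 2 = 2 * p + 2 by omega,
    show 3 * (2 + p) - 2 = 3 * p + 4 by omega, Nat.choose_succ_succ]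
  have hs := Nat.choose_succ_right_eq (2 * p + 2) p
  rw [show 2 * p + 2 - p = p + 2 by omega] at hs
  linarith

theorem ZMod.val_intCast_of_lt {m : ℕ} [NeZero m] {t : ℤ} (h0 : 0 ≤ t) (h1 : t < m) :
    ((t : ZMod m).val : ℤ) = t := by
  rw [ZMod.val_intCast, Int.emod_eq_of_lt h0 h1]

theorem arcMem_intCast_iff {m : ℕ} [NeZero m] {a b : ℤ} (h0 : 0 ≤ b - a) (h1 : b - a < m)
    (x : ZMod m) : arcMem m a b x ↔ ∃ y : ℤ, (y : ZMod m) = x ∧ a < y ∧ y < b := by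
  have hv := ZMod.val_intCast_of_lt h0 h1
  push_cast at hv
  unfold arcMem
  constructor
  · rintro ⟨h2, h3⟩
    refine ⟨a + ((x - a).val : ℤ), by simp, by omega, by omega⟩
  · rintro ⟨y, rfl, h2, h3⟩
    have hy := ZMod.val_intCast_of_lt (m := m) (t := y - a) (by omega) (by omega)
    push_cast at hy
    omega

theorem crossPairs_swap_left {m : ℕ} {a b c d : ZMod m} :
    crossPairs m b a c d ↔ crossPairs m a b c d := by
  unfold crossPairs
  tauto

theorem crossPairs_swap_right {m : ℕ} {a b c d : ZMod m} :
    crossPairs m a b d c ↔ crossPairs m a b c d := by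
  unfold crossPairs
  tauto

theorem crosses_mk_iff {m : ℕ} {a b c d : ZMod m} :
    Crosses m s(a, b) s(c, d) ↔ crossPairs m a b c d := by
  constructor
  · rintro ⟨a', b', c', d', h1, h2, h3⟩
    rw [Sym2.eq_iff] at h1 h2
    rcases h1 with ⟨rfl, rfl⟩ | ⟨rfl, rfl⟩ <;> rcases h2 with ⟨rfl, rfl⟩ | ⟨rfl, rfl⟩
    · exact h3
    · exact crossPairs_swap_right.1 h3
    · exact crossPairs_swap_left.1 h3
    · exact crossPairs_swap_left.1 (crossPairs_swap_right.1 h3)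
  · intro h
    exact ⟨a, b, c, d, rfl, rfl, h⟩

section Lift

variable {n : ℕ}

theorem intCast_add_two_mul (a : ℤ) : ((a + 2 * n : ℤ) : ZMod (2 * n)) = a := by
  rw [ZMod.intCast_eq_intCast_iff_dvd_sub]
  exact ⟨-1, by push_cast; ring⟩

theorem eq_of_intCast_eq {x y : ℤ} (h : (x : ZMod (2 * n)) = y) (h1 : x - y < 2 * n)
    (h2 : y - x < 2 * n) : x = y := by
  rw [ZMod.intCast_eq_intCast_iff_dvd_sub] at h
  have := Int.eq_zero_of_abs_lt_dvd h (abs_lt.2 (by push_cast; omega))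
  omega

theorem arcMem_compl_iff [NeZero (2 * n)] {a b : ℤ} (h0 : 0 < b - a) (h1 : b - a ≤ 2 * n)
    (x : ZMod (2 * n)) :
    arcMem (2 * n) b a x ↔ ∃ y : ℤ, (y : ZMod (2 * n)) = x ∧ b < y ∧ y < a + 2 * n := by
  rw [← intCast_add_two_mul a]
  exact arcMem_intCast_iff (by omega) (by push_cast; omega) x

theorem crosses_intCast_iff [NeZero (2 * n)] {a b c d : ℤ} (h1 : 2 ≤ b - a) (h2 : b - a < n)
    (h3 : 2 ≤ d - c) (h4 : d - c < n) :
    Crosses (2 * n) s((a : ZMod (2 * n)), (b : ZMod (2 * n)))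
        s((c : ZMod (2 * n)), (d : ZMod (2 * n))) ↔
      ∃ c' d' : ℤ, (c' : ZMod (2 * n)) = c ∧ (d' : ZMod (2 * n)) = d ∧ d' - c' = d - c ∧
        (c' < a ∧ a < d' ∧ d' < b ∨ a < c' ∧ c' < b ∧ b < d') := by
  rw [crosses_mk_iff, crossPairs]
  simp only [arcMem_compl_iff (n := n) (show 0 < b - a by omega) (by omega),
    arcMem_intCast_iff (m := 2 * n) (show 0 ≤ b - a by omega) (by push_cast; omega)]
  constructor
  · rintro (⟨⟨x, hx, g1, g2⟩, ⟨y, hy, g3, g4⟩⟩ | ⟨⟨y, hy, g1, g2⟩, ⟨x, hx, g3, g4⟩⟩)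
    · have := eq_of_intCast_eq (n := n) (x := y - x) (y := d - c) (by push_cast; rw [hx, hy])
        (by omega) (by omega)
      exact ⟨x, y, hx, hy, this, Or.inr ⟨g1, g2, g3⟩⟩
    · have hx' : ((x - 2 * n : ℤ) : ZMod (2 * n)) = c := by
        rw [← intCast_add_two_mul, sub_add_cancel, hx]
      have := eq_of_intCast_eq (n := n) (x := y - (x - 2 * n)) (y := d - c)
        (by rw [Int.cast_sub, hx', hy, Int.cast_sub]) (by omega) (by omega)
      exact ⟨x - 2 * n, y, hx', hy, this, Or.inl ⟨by omega, g1, g2⟩⟩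
  · rintro ⟨x, y, hx, hy, hxy, ⟨g1, g2, g3⟩ | ⟨g1, g2, g3⟩⟩
    · refine Or.inr ⟨⟨y, hy, g2, g3⟩, ⟨x + 2 * n, ?_, by omega, by omega⟩⟩
      rw [intCast_add_two_mul, hx]
    · exact Or.inl ⟨⟨x, hx, g1, g2⟩, ⟨y, hy, g3, by omega⟩⟩

theorem diagCrossCentral_intCast_iff [NeZero (2 * n)] {a b : ℤ} (h1 : 2 ≤ b - a)
    (h2 : b - a < n) (c : ZMod (2 * n)) :
    diagCrossCentral n s((a : ZMod (2 * n)), (b : ZMod (2 * n))) c ↔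
      ∃ y : ℤ, (y : ZMod (2 * n)) = c ∧ a < y ∧ y < b := by
  rw [← arcMem_intCast_iff (m := 2 * n) (show 0 ≤ b - a by omega) (by push_cast; omega)]
  constructor
  · rintro ⟨a', b', h, h3, h4⟩
    rw [Sym2.eq_iff] at h
    rcases h with ⟨rfl, rfl⟩ | ⟨rfl, rfl⟩
    · exact h4
    · have := ZMod.val_intCast_of_lt (m := 2 * n) (t := a + 2 * n - b) (by omega)
        (by push_cast; omega)
      rw [Int.cast_sub, intCast_add_two_mul] at this
      omega
  · intro h
    refine ⟨a, b, rfl, ?_, h⟩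
    have := ZMod.val_intCast_of_lt (m := 2 * n) (t := b - a) (by omega) (by push_cast; omega)
    push_cast at this
    omega

theorem isValid_diag_iff [NeZero (2 * n)] (e : Sym2 (ZMod (2 * n))) :
    DChord.IsValid n (.diag e) ↔
      ∃ a b : ℤ, 2 ≤ b - a ∧ b - a < n ∧ e = s((a : ZMod (2 * n)), (b : ZMod (2 * n))) := by
  constructor
  · rintro ⟨a, b, rfl, h1, h2, h3, h4⟩
    obtain ⟨x, rfl⟩ := ZMod.intCast_surjective a
    obtain ⟨t, ht⟩ : ∃ t : ℕ, (b - x).val = t := ⟨_, rfl⟩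
    have hb : b = x + t := by
      rw [← ht, ZMod.natCast_zmod_val]
      ring
    subst hb
    have htlt : t < 2 * n := ht ▸ ZMod.val_lt _
    have e1 : t ≠ 0 := by
      rintro rfl
      simp at h1
    have e2 : t ≠ 1 := by
      rintro rfl
      simp at h2
    have e3 : t + 1 ≠ 2 * n := by
      intro h
      apply h3
      have : ((t + 1 : ℕ) : ZMod (2 * n)) = 0 := by rw [h, ZMod.natCast_self]
      push_cast at this
      rw [add_assoc, this, add_zero]
    have e4 : t ≠ n := by
      rintro rfl
      exact h4 rfl
    rcases lt_or_gt_of_ne e4 with h | h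
    · exact ⟨x, x + t, by omega, by omega, by simp⟩
    · refine ⟨x + t, x + 2 * n, by omega, by omega, ?_⟩
      rw [intCast_add_two_mul, Sym2.eq_swap]
      simp
  · rintro ⟨a, b, h1, h2, rfl⟩
    refine ⟨a, b, rfl, fun h => ?_, fun h => ?_, fun h => ?_, fun h => ?_⟩
    · have := eq_of_intCast_eq h (by omega) (by omega)
      omega
    · have := eq_of_intCast_eq (n := n) (x := b) (y := a + 1) (by push_cast; exact h) (by omega)
        (by omega)
      omega
    · have := eq_of_intCast_eq (n := n) (x := a) (y := b + 1) (by push_cast; exact h) (by omega)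
        (by omega)
      omega
    · have := eq_of_intCast_eq (n := n) (x := b) (y := a + n) (by push_cast; exact h) (by omega)
        (by omega)
      omega

theorem mk_intCast_eq_iff {a b c d : ℤ} (h1 : 2 ≤ b - a) (h2 : b - a < n)
    (h3 : 2 ≤ d - c) (h4 : d - c < n) :
    s((a : ZMod (2 * n)), (b : ZMod (2 * n))) = s((c : ZMod (2 * n)), (d : ZMod (2 * n))) ↔
      ∃ j : ℤ, c = a + n * (2 * j) ∧ d = b + n * (2 * j) := by
  rw [Sym2.eq_iff]
  constructor
  · rintro (⟨g1, g2⟩ | ⟨g1, g2⟩)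
    · have := eq_of_intCast_eq (n := n) (x := b - a) (y := d - c) (by push_cast; rw [g1, g2])
        (by omega) (by omega)
      rw [ZMod.intCast_eq_intCast_iff_dvd_sub] at g1
      obtain ⟨j, hj⟩ := g1
      push_cast at hj
      exact ⟨j, by linarith, by linarith⟩
    · have := eq_of_intCast_eq (n := n) (x := (b - a) + (d - c)) (y := 0)
        (by push_cast; rw [g1, g2]; ring)
      omega
  · rintro ⟨j, rfl, rfl⟩
    left
    constructor <;>
    · rw [ZMod.intCast_eq_intCast_iff_dvd_sub]
      exact ⟨j, by push_cast; ring⟩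

/-- The lift to the universal cover of the diagonals in a set of chords. -/
def liftDiag (T : Finset (DChord n)) (a b : ℤ) : Prop :=
  2 ≤ b - a ∧ b - a < n ∧ DChord.diag s((a : ZMod (2 * n)), (b : ZMod (2 * n))) ∈ T

/-- The lift to the universal cover of the central chords in a set of chords. -/
def liftCentral (T : Finset (DChord n)) (c : ℤ) (s : Bool) : Prop :=
  DChord.central (c : ZMod (2 * n)) s ∈ T

theorem intCast_eq_or_iff (c d : ℤ) :
    ((d : ZMod (2 * n)) = c ∨ (d : ZMod (2 * n)) = c + n) ↔ (n : ℤ) ∣ d - c := by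
  have e : (c : ZMod (2 * n)) + n = ((c + n : ℤ) : ZMod (2 * n)) := by push_cast; rfl
  rw [e, ZMod.intCast_eq_intCast_iff_dvd_sub, ZMod.intCast_eq_intCast_iff_dvd_sub]
  push_cast
  constructor
  · rintro (⟨j, hj⟩ | ⟨j, hj⟩)
    · exact ⟨-(2 * j), by linarith⟩
    · exact ⟨1 - 2 * j, by linarith⟩
  · rintro ⟨j, hj⟩
    obtain ⟨i, hi⟩ := Int.even_or_odd' j
    rcases hi with rfl | rfl
    · exact Or.inl ⟨-i, by linarith⟩
    · exact Or.inr ⟨-i, by linarith⟩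

theorem rot_diag_intCast (a b : ℤ) :
    DChord.rot n (.diag s((a : ZMod (2 * n)), (b : ZMod (2 * n)))) =
      .diag s(((a + n : ℤ) : ZMod (2 * n)), ((b + n : ℤ) : ZMod (2 * n))) := by
  simp [DChord.rot]

theorem rot_central_intCast (c : ℤ) (s : Bool) :
    DChord.rot n (.central (c : ZMod (2 * n)) s) = .central ((c + n : ℤ) : ZMod (2 * n)) s := by
  simp [DChord.rot]

theorem DCSTriangulation.isPeriodicTriangulation [NeZero (2 * n)] {T : Finset (DChord n)}
    (hT : DCSTriangulation n T) :
    IsPeriodicTriangulation n (liftDiag T) (liftCentral T) where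
  two_le _ _ h := h.1
  lt_n _ _ h := h.2.1
  shift_diag a b := by
    constructor
    · rintro ⟨h1, h2, h3⟩
      refine ⟨by omega, by omega, ?_⟩
      have := hT.2 _ h3
      rwa [rot_diag_intCast, add_assoc, add_assoc, ← two_mul, intCast_add_two_mul,
        intCast_add_two_mul] at this
    · rintro ⟨h1, h2, h3⟩
      refine ⟨by omega, by omega, ?_⟩
      rw [← rot_diag_intCast]
      exact hT.2 _ h3
  shift_central c s := by
    constructor
    · intro h
      have := hT.2 _ h
      rwa [rot_central_intCast, add_assoc, ← two_mul, intCast_add_two_mul] at this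
    · intro h
      rw [liftCentral, ← rot_central_intCast]
      exact hT.2 _ h
  diag_diag := by
    rintro a b c d ⟨h1, h2, h3⟩ ⟨h4, h5, h6⟩ hac hcb
    by_contra hbd
    exact hT.1.2.1 _ h3 _ h6 ((crosses_intCast_iff h1 h2 h4 h5).2
      ⟨c, d, rfl, rfl, rfl, Or.inr ⟨hac, hcb, by omega⟩⟩)
  diag_central := by
    rintro a b c s ⟨h1, h2, h3⟩ h4 hac
    by_contra hcb
    exact hT.1.2.1 _ h3 _ h4 ((diagCrossCentral_intCast_iff h1 h2 _).2
      ⟨c, rfl, hac, by omega⟩)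
  central_central c d s h1 h2 := by
    rw [← intCast_eq_or_iff]
    have := hT.1.2.1 _ h1 _ h2
    by_contra hcd
    rw [not_or] at hcd
    exact this ⟨by simp, hcd⟩
  diag_maximal a b h1 h2 hA := by
    obtain ⟨f | ⟨z, s⟩, hf, hcross⟩ := hT.1.2.2 _ ((isValid_diag_iff _).2 ⟨a, b, h1, h2, rfl⟩)
      (fun h => hA ⟨h1, h2, h⟩)
    · obtain ⟨c, d, h3, h4, rfl⟩ := (isValid_diag_iff f).1 (hT.1.1 _ hf)
      obtain ⟨c', d', hc, hd, hcd, h⟩ := (crosses_intCast_iff h1 h2 h3 h4).1 hcross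
      exact Or.inl ⟨c', d', ⟨by omega, by omega, by rwa [hc, hd]⟩, h⟩
    · obtain ⟨y, rfl, h⟩ := (diagCrossCentral_intCast_iff h1 h2 _).1 hcross
      exact Or.inr ⟨y, s, hf, h⟩
  central_maximal c s hC := by
    obtain ⟨f | ⟨z, s'⟩, hf, hcross⟩ := hT.1.2.2 (.central c s) trivial hC
    · obtain ⟨a, b, h1, h2, rfl⟩ := (isValid_diag_iff f).1 (hT.1.1 _ hf)
      obtain ⟨y, hy, h3, h4⟩ := (diagCrossCentral_intCast_iff h1 h2 _).1 hcross
      obtain ⟨j, hj⟩ := (ZMod.intCast_eq_intCast_iff_dvd_sub _ _ _).1 hy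
      push_cast at hj
      refine Or.inl ⟨a + 2 * n * j, b + 2 * n * j, ⟨by linarith, by linarith, ?_⟩, by linarith,
        by linarith⟩
      rwa [← (mk_intCast_eq_iff (n := n) h1 h2 (by linarith) (by linarith)).2
        ⟨j, by ring, by ring⟩]
    · obtain ⟨d, rfl⟩ := ZMod.intCast_surjective z
      have hs : s' = !s := Bool.eq_not.2 (Ne.symm hcross.1)
      subst hs
      refine Or.inr ⟨d, hf, ?_⟩
      rw [← intCast_eq_or_iff, not_or]
      exact hcross.2

theorem dcsTriangulation_of_lift [NeZero (2 * n)] {T : Finset (DChord n)}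
    (hv : ∀ e ∈ T, DChord.IsValid n e)
    (h : IsPeriodicTriangulation n (liftDiag T) (liftCentral T)) : DCSTriangulation n T := by
  have hdc : ∀ (e : Sym2 (ZMod (2 * n))) (z : ZMod (2 * n)) (s : Bool), DChord.diag e ∈ T →
      DChord.central z s ∈ T → ¬ diagCrossCentral n e z := by
    intro e z s he hz hcross
    obtain ⟨a, b, h1, h2, rfl⟩ := (isValid_diag_iff e).1 (hv _ he)
    obtain ⟨y, rfl, h3, h4⟩ := (diagCrossCentral_intCast_iff h1 h2 _).1 hcross
    have := h.diag_central a b y s ⟨h1, h2, he⟩ hz h3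
    omega
  refine ⟨⟨hv, ?_, ?_⟩, ?_⟩
  · rintro (e | ⟨z, s⟩) he (f | ⟨w, s'⟩) hf hcross
    · obtain ⟨a, b, h1, h2, rfl⟩ := (isValid_diag_iff e).1 (hv _ he)
      obtain ⟨c, d, h3, h4, rfl⟩ := (isValid_diag_iff f).1 (hv _ hf)
      obtain ⟨c', d', hc, hd, hcd, g⟩ := (crosses_intCast_iff h1 h2 h3 h4).1 hcross
      have h5 : liftDiag T c' d' := ⟨by omega, by omega, by rwa [hc, hd]⟩
      rcases g with ⟨g1, g2, g3⟩ | ⟨g1, g2, g3⟩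
      · have := h.diag_diag c' d' a b h5 ⟨h1, h2, he⟩ g1 g2
        omega
      · have := h.diag_diag a b c' d' ⟨h1, h2, he⟩ h5 g1 g2
        omega
    · exact hdc e w s' he hf hcross
    · exact hdc f z s hf he hcross
    · obtain ⟨c, rfl⟩ := ZMod.intCast_surjective z
      obtain ⟨d, rfl⟩ := ZMod.intCast_surjective w
      have hs : s' = !s := Bool.eq_not.2 (Ne.symm hcross.1)
      subst hs
      have := h.central_central c d s he hf
      rw [← intCast_eq_or_iff] at this
      exact this.elim hcross.2.1 hcross.2.2
  · rintro (e | ⟨z, s⟩) he hT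
    · obtain ⟨a, b, h1, h2, rfl⟩ := (isValid_diag_iff e).1 he
      rcases h.diag_maximal a b h1 h2 (fun hA => hT hA.2.2) with
        ⟨c, d, ⟨h3, h4, hcd⟩, g⟩ | ⟨c, s, hc, g⟩
      · exact ⟨_, hcd, (crosses_intCast_iff h1 h2 h3 h4).2 ⟨c, d, rfl, rfl, rfl, g⟩⟩
      · exact ⟨_, hc, (diagCrossCentral_intCast_iff h1 h2 _).2 ⟨c, rfl, g⟩⟩
    · obtain ⟨c, rfl⟩ := ZMod.intCast_surjective z
      rcases h.central_maximal c s hT with ⟨a, b, ⟨h1, h2, hab⟩, g⟩ | ⟨d, hd, hdc⟩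
      · exact ⟨_, hab, (diagCrossCentral_intCast_iff h1 h2 _).2 ⟨c, rfl, g⟩⟩
      · rw [← intCast_eq_or_iff, not_or] at hdc
        exact ⟨_, hd, by simp, hdc⟩
  · rintro (e | ⟨z, s⟩) he
    · obtain ⟨a, b, h1, h2, rfl⟩ := (isValid_diag_iff e).1 (hv _ he)
      rw [rot_diag_intCast]
      exact ((h.shift_diag a b).2 ⟨h1, h2, he⟩).2.2
    · obtain ⟨c, rfl⟩ := ZMod.intCast_surjective z
      rw [rot_central_intCast]
      exact (h.shift_central c s).2 he

instance [NeZero (2 * n)] : Finite (DChord n) :=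
  Finite.of_surjective
    (Sum.elim DChord.diag (fun p => DChord.central p.1 p.2) :
      Sym2 (ZMod (2 * n)) ⊕ ZMod (2 * n) × Bool → DChord n)
    (by
      rintro (e | ⟨z, s⟩)
      · exact ⟨Sum.inl e, rfl⟩
      · exact ⟨Sum.inr (z, s), rfl⟩)

theorem IsPeriodicTriangulation.exists_lift [NeZero (2 * n)] {A : ℤ → ℤ → Prop}
    {C : ℤ → Bool → Prop} (h : IsPeriodicTriangulation n A C) :
    ∃ T : Finset (DChord n), DCSTriangulation n T ∧ liftDiag T = A ∧ liftCentral T = C := by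
  let S : Set (DChord n) :=
    {x | (∃ a b : ℤ, A a b ∧ x = .diag s((a : ZMod (2 * n)), (b : ZMod (2 * n)))) ∨
      ∃ (c : ℤ) (s : Bool), C c s ∧ x = .central (c : ZMod (2 * n)) s}
  have hfin : S.Finite := Set.toFinite S
  have hA : liftDiag hfin.toFinset = A := by
    funext a b
    refine propext ⟨?_, fun hab => ⟨h.two_le a b hab, h.lt_n a b hab, ?_⟩⟩
    · rintro ⟨h1, h2, h3⟩
      rw [Set.Finite.mem_toFinset] at h3
      rcases h3 with ⟨c, d, hcd, heq⟩ | ⟨c, s, -, heq⟩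
      · rw [DChord.diag.injEq,
          mk_intCast_eq_iff h1 h2 (h.two_le c d hcd) (h.lt_n c d hcd)] at heq
        obtain ⟨j, rfl, rfl⟩ := heq
        have hp : Function.Periodic (fun x => A (a + x) (b + x)) (n : ℤ) := fun x => by
          simp only [← add_assoc]
          exact propext (h.shift_diag (a + x) (b + x))
        have := hp.int_mul (2 * j) 0
        simp only [zero_add, add_zero, Int.cast_id, mul_comm _ (n : ℤ)] at this
        exact (iff_of_eq this).1 hcd
      · cases heq
    · rw [Set.Finite.mem_toFinset]
      exact Or.inl ⟨a, b, hab, rfl⟩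
  have hC : liftCentral hfin.toFinset = C := by
    funext c s
    refine propext ⟨fun hc => ?_, fun hc => ?_⟩
    · rw [liftCentral, Set.Finite.mem_toFinset] at hc
      rcases hc with ⟨a, b, -, heq⟩ | ⟨d, s', hd, heq⟩
      · cases heq
      · rw [DChord.central.injEq] at heq
        obtain ⟨hcd, rfl⟩ := heq
        obtain ⟨j, hj⟩ := (ZMod.intCast_eq_intCast_iff_dvd_sub _ _ _).1 hcd
        push_cast at hj
        have hp : Function.Periodic (fun x => C x s) (n : ℤ) :=
          fun x => propext (h.shift_central x s)
        have := hp.int_mul (2 * j) c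
        rw [Int.cast_id, show c + 2 * j * n = d by linarith] at this
        exact (iff_of_eq this).1 hd
    · rw [liftCentral, Set.Finite.mem_toFinset]
      exact Or.inr ⟨c, s, hc, rfl⟩
  refine ⟨hfin.toFinset, dcsTriangulation_of_lift ?_ (by rwa [hA, hC]), hA, hC⟩
  intro e he
  rw [Set.Finite.mem_toFinset] at he
  rcases he with ⟨a, b, hab, rfl⟩ | ⟨c, s, -, rfl⟩
  · exact (isValid_diag_iff _).2 ⟨a, b, h.two_le a b hab, h.lt_n a b hab, rfl⟩
  · trivial

theorem subset_of_lift [NeZero (2 * n)] {T T' : Finset (DChord n)}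
    (hv : ∀ e ∈ T, DChord.IsValid n e) (h1 : liftDiag T = liftDiag T')
    (h2 : liftCentral T = liftCentral T') : T ⊆ T' := by
  rintro (e | ⟨z, s⟩) he
  · obtain ⟨a, b, h3, h4, rfl⟩ := (isValid_diag_iff e).1 (hv _ he)
    have hab : liftDiag T a b := ⟨h3, h4, he⟩
    rw [h1] at hab
    exact hab.2.2
  · obtain ⟨c, rfl⟩ := ZMod.intCast_surjective z
    have hc : liftCentral T c s := he
    rw [h2] at hc
    exact hc

end Lift

theorem card_dcsTriangulation {n : ℕ} [NeZero n] (hn : 2 ≤ n) :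
    Nat.card {T : Finset (DChord n) // DCSTriangulation n T} = Nat.card (ChordCode n) := by
  have : NeZero (2 * n) := ⟨by omega⟩
  choose f hf using fun T : {T : Finset (DChord n) // DCSTriangulation n T} =>
    ChordCode.exists_eq_chords hn T.2.isPeriodicTriangulation
  refine Nat.card_eq_of_bijective f ⟨fun T T' h => ?_, fun p => ?_⟩
  · have h1 : liftDiag T.1 = liftDiag T'.1 := by rw [← (hf T).1, ← (hf T').1, h]
    have h2 : liftCentral T.1 = liftCentral T'.1 := by rw [← (hf T).2, ← (hf T').2, h]
    exact Subtype.ext ((subset_of_lift T.2.1.1 h1 h2).antisymm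
      (subset_of_lift T'.2.1.1 h1.symm h2.symm))
  · obtain ⟨T, hT, h1, h2⟩ :=
      (p.isPotential.isPeriodicTriangulation hn p.1.2).exists_lift
    exact ⟨⟨T, hT⟩, ChordCode.ext_of_chords hn ((hf ⟨T, hT⟩).1.trans h1)
      ((hf ⟨T, hT⟩).2.trans h2)⟩

/-- The number of centrally symmetric triangulations of the punctured `2n`-gon (the number of
vertices of the type-D associahedron `\U0001d521ₙ`) is `((3n-2)/n) · binom(2n-2, n-1)`
(stated multiplied through by `n` to stay in the natural numbers). -/
theorem typeD_vertex_count (n : ℕ) (hn : 2 ≤ n) :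
    n * Nat.card {T : Finset (DChord n) // DCSTriangulation n T} =
      (3 * n - 2) * Nat.choose (2 * n - 2) (n - 1) := by
  have : NeZero n := ⟨by omega⟩
  rw [card_dcsTriangulation hn]
  exact ChordCode.card hn
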